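/- Fix q > 1, b ∈ ℝ, c > 0 and a Lévy measure ν with I(q) = ∫_{x≥1} e^{qx/(q−1)} dν(x) < ∞, and let β be the unique real solution of F(u) = 0. For a Borel measurable Y : ℝ → [0,∞) with ∫ |eˣ−1|·Y(x) dν(x) < ∞, define k(Y) = (q(q−1)/(2c))·( b + c/2 + ∫ ((eˣ−1)Y(x) − h(x)) dν(x) )² + ∫ (Y(x)^q − q(Y(x)−1) − 1) dν(x) ∈ [0,∞] (the second integrand is nonnegative). Then for every such Y one has k(Y) ≥ k(Y_β), and k(Y) = k(Y_β) implies Y = Y_β ν-almost everywhere. -/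

import Mathlib

open MeasureTheory Filter Set
open scoped ENNReal

/-- The truncation function `h(x) = x · 1_{|x| ≤ 1}`. -/
noncomputable def htrunc (x : ℝ) : ℝ := if |x| ≤ 1 then x else 0

/-- `Y_u(x) = (1 + (q-1)u(eˣ-1))^{1/(q-1)}` if `1 + (q-1)u(eˣ-1) ≥ 0`, else `0`. -/
noncomputable def Yq (q u x : ℝ) : ℝ :=
  if 0 ≤ 1 + (q - 1) * u * (Real.exp x - 1) then
    (1 + (q - 1) * u * (Real.exp x - 1)) ^ (1 / (q - 1))
  else 0

/-- `F(u) = b + c/2 + c·u + ∫ ((eˣ-1)Y_u(x) - h(x)) dν(x)`. -/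
noncomputable def Fq (q b c : ℝ) (ν : Measure ℝ) (u : ℝ) : ℝ :=
  b + c / 2 + c * u + ∫ x, ((Real.exp x - 1) * Yq q u x - htrunc x) ∂ν

/-- `k(Y) = (q(q-1)/(2c))·(b + c/2 + ∫ ((eˣ-1)Y(x) - h(x)) dν)² +
∫ (Y^q - q(Y-1) - 1) dν ∈ [0,∞]` (the second integrand is nonnegative). -/
noncomputable def kfun (q b c : ℝ) (ν : Measure ℝ) (Y : ℝ → ℝ) : ℝ≥0∞ :=
  ENNReal.ofReal (q * (q - 1) / (2 * c) *
      (b + c / 2 + ∫ x, ((Real.exp x - 1) * Y x - htrunc x) ∂ν) ^ 2) +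
    ∫⁻ x, ENNReal.ofReal (Y x ^ q - q * (Y x - 1) - 1) ∂ν

/-- The nonnegative convex function `y ↦ y^q - q(y-1) - 1` of the Hellinger integral. -/
noncomputable def hellinger (q y : ℝ) : ℝ := y ^ q - q * (y - 1) - 1

theorem hellinger_nonneg {q y : ℝ} (hq : 1 < q) (hy : 0 ≤ y) : 0 ≤ hellinger q y := by
  have h := one_add_mul_self_le_rpow_one_add (s := y - 1) (by linarith) hq.le
  rw [add_sub_cancel] at h
  unfold hellinger
  linarith

theorem rpow_tangent_lt {q y z : ℝ} (hq : 1 < q) (hy : 0 ≤ y) (hz : 0 ≤ z) (hyz : y ≠ z) :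
    z ^ q + q * z ^ (q - 1) * (y - z) < y ^ q := by
  rcases hz.eq_or_lt with rfl | hz
  · rw [Real.zero_rpow (by linarith), Real.zero_rpow (by linarith)]
    have := Real.rpow_pos_of_pos (hy.lt_of_ne' hyz) q
    simpa using this
  · have hs : y / z - 1 ≠ 0 := by
      rw [sub_ne_zero, Ne, div_eq_one_iff_eq hz.ne']
      exact hyz
    have h := one_add_mul_self_lt_rpow_one_add (s := y / z - 1)
      (by have := div_nonneg hy hz.le; linarith) hs hq
    rw [add_sub_cancel, Real.div_rpow hy hz.le, lt_div_iff₀ (Real.rpow_pos_of_pos hz q)] at h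
    have hzq : z ^ (q - 1) = z ^ q / z := Real.rpow_sub_one hz.ne' q
    calc z ^ q + q * z ^ (q - 1) * (y - z) = (1 + q * (y / z - 1)) * z ^ q := by
          rw [hzq]; field_simp
      _ < y ^ q := h

theorem rpow_tangent_le {q y z : ℝ} (hq : 1 < q) (hy : 0 ≤ y) (hz : 0 ≤ z) :
    z ^ q + q * z ^ (q - 1) * (y - z) ≤ y ^ q := by
  rcases eq_or_ne y z with rfl | h
  · simp
  · exact (rpow_tangent_lt hq hy hz h).le

theorem Yq_nonneg (q u x : ℝ) : 0 ≤ Yq q u x := by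
  unfold Yq
  split_ifs with h
  · exact Real.rpow_nonneg h _
  · exact le_rfl

theorem measurable_Yq (q u : ℝ) : Measurable (Yq q u) := by
  unfold Yq
  exact Measurable.ite (measurableSet_le (by fun_prop) (by fun_prop)) (by fun_prop) (by fun_prop)

theorem measurable_htrunc : Measurable htrunc := by
  unfold htrunc
  exact Measurable.ite (measurableSet_le (by fun_prop) (by fun_prop)) (by fun_prop) (by fun_prop)

/-- The first-order condition satisfied by `Yq q u x`, multiplied by an admissible direction. -/
theorem mul_sub_le_Yq_rpow_mul_sub {q u x y : ℝ} (hq : 1 < q) (hy : 0 ≤ y) :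
    (q - 1) * u * (Real.exp x - 1) * (y - Yq q u x) ≤
      (Yq q u x ^ (q - 1) - 1) * (y - Yq q u x) := by
  unfold Yq
  split_ifs with h
  · rw [← Real.rpow_mul h, one_div_mul_cancel (by linarith), Real.rpow_one]
    linarith
  · rw [Real.zero_rpow (by linarith)]
    nlinarith

theorem hellinger_tangent_le {q u x y : ℝ} (hq : 1 < q) (hy : 0 ≤ y) :
    hellinger q (Yq q u x) + q * (q - 1) * u * ((Real.exp x - 1) * (y - Yq q u x)) ≤
      hellinger q y := by
  have h1 := rpow_tangent_le hq hy (Yq_nonneg q u x)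
  have h2 := mul_le_mul_of_nonneg_left (mul_sub_le_Yq_rpow_mul_sub (u := u) (x := x) hq hy)
    (by linarith : 0 ≤ q)
  unfold hellinger
  linarith

theorem hellinger_tangent_lt {q u x y : ℝ} (hq : 1 < q) (hy : 0 ≤ y) (hne : y ≠ Yq q u x) :
    hellinger q (Yq q u x) + q * (q - 1) * u * ((Real.exp x - 1) * (y - Yq q u x)) <
      hellinger q y := by
  have h1 := rpow_tangent_lt hq hy (Yq_nonneg q u x) hne
  have h2 := mul_le_mul_of_nonneg_left (mul_sub_le_Yq_rpow_mul_sub (u := u) (x := x) hq hy)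
    (by linarith : 0 ≤ q)
  unfold hellinger
  linarith

theorem hellinger_Yq_le {q u x : ℝ} (hq : 1 < q) :
    hellinger q (Yq q u x) ≤ q * (q - 1) * u * ((Real.exp x - 1) * (Yq q u x - 1)) := by
  have h := hellinger_tangent_le (u := u) (x := x) hq zero_le_one
  have h1 : hellinger q 1 = 0 := by simp [hellinger]
  linarith

theorem abs_rpow_sub_one_le {s p : ℝ} (hs : 0 ≤ s) (hp : 0 ≤ p) :
    |s ^ p - 1| ≤ (1 + p) * max 1 s ^ p * |s - 1| := by
  rcases le_total s 1 with h | h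
  · have hb := one_add_mul_self_le_rpow_one_add (s := s - 1) (p := 1 + p)
      (by linarith) (by linarith)
    rw [add_sub_cancel] at hb
    have hmono : s ^ (1 + p) ≤ s ^ p := by
      rcases hs.eq_or_lt with rfl | hs
      · rw [Real.zero_rpow (by linarith)]
        exact Real.rpow_nonneg le_rfl _
      · exact Real.rpow_le_rpow_of_exponent_ge hs h (by linarith)
    rw [max_eq_left h, Real.one_rpow, abs_of_nonpos (by linarith : s - 1 ≤ 0),
      abs_of_nonpos (by linarith [Real.rpow_le_one hs h hp])]
    linarith
  · have hs0 : 0 < s := by linarith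
    have h1 : 1 - p * Real.log s ≤ (s ^ p)⁻¹ := by
      rw [Real.rpow_def_of_pos hs0, ← Real.exp_neg]
      linarith [Real.add_one_le_exp (-(Real.log s * p))]
    have h2 : Real.log s ≤ s - 1 := Real.log_le_sub_one_of_pos hs0
    have hsp : 0 < s ^ p := Real.rpow_pos_of_pos hs0 p
    have h3 : 1 ≤ s ^ p := Real.one_le_rpow h hp
    have h4 : 1 - p * (s - 1) ≤ (s ^ p)⁻¹ := by nlinarith
    have h5 := mul_le_mul_of_nonneg_right h4 hsp.le
    rw [inv_mul_cancel₀ hsp.ne'] at h5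
    rw [max_eq_right h, abs_of_nonneg (by linarith : 0 ≤ s - 1), abs_of_nonneg (by linarith)]
    nlinarith [mul_nonneg hsp.le (by linarith : 0 ≤ s - 1)]

theorem Yq_le {q u x m : ℝ} (hq : 1 < q) (hm : 1 ≤ m) (hx : Real.exp x ≤ m) :
    max 1 (1 + (q - 1) * u * (Real.exp x - 1)) ≤ (1 + (q - 1) * |u|) * m ∧
      Yq q u x ≤ ((1 + (q - 1) * |u|) * m) ^ (1 / (q - 1)) := by
  have hu : 0 ≤ (q - 1) * |u| := mul_nonneg (by linarith) (abs_nonneg u)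
  have h1 : u * (Real.exp x - 1) ≤ |u| * m := by
    calc u * (Real.exp x - 1) ≤ |u * (Real.exp x - 1)| := le_abs_self _
      _ = |u| * |Real.exp x - 1| := abs_mul _ _
      _ ≤ |u| * m := by
        gcongr
        rw [abs_le]
        constructor <;> linarith [Real.exp_pos x]
  have hmax : max 1 (1 + (q - 1) * u * (Real.exp x - 1)) ≤ (1 + (q - 1) * |u|) * m := by
    apply max_le
    · nlinarith
    · nlinarith
  refine ⟨hmax, ?_⟩
  have hp : 0 ≤ 1 / (q - 1) := by
    apply div_nonneg <;> linarith
  unfold Yq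
  split_ifs with h
  · exact Real.rpow_le_rpow h ((le_max_right _ _).trans hmax) hp
  · positivity

theorem abs_Yq_sub_one_le {q u x m : ℝ} (hq : 1 < q) (hm : 1 ≤ m) (hx : Real.exp x ≤ m) :
    |Yq q u x - 1| ≤ (1 + 1 / (q - 1)) * ((1 + (q - 1) * |u|) * m) ^ (1 / (q - 1)) *
      ((q - 1) * |u| * |Real.exp x - 1|) := by
  have hp : 0 ≤ 1 / (q - 1) := by
    apply div_nonneg <;> linarith
  have hmax := (Yq_le (u := u) hq hm hx).1
  have habs : |1 + (q - 1) * u * (Real.exp x - 1) - 1| = (q - 1) * |u| * |Real.exp x - 1| := by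
    rw [add_sub_cancel_left, abs_mul, abs_mul, abs_of_pos (by linarith : 0 < q - 1)]
  rw [← habs]
  have hM : 1 ≤ (1 + (q - 1) * |u|) * m := (le_max_left _ _).trans hmax
  unfold Yq
  split_ifs with h
  · refine (abs_rpow_sub_one_le h hp).trans ?_
    gcongr
  · have h1 : 1 ≤ |1 + (q - 1) * u * (Real.exp x - 1) - 1| := by
      rw [abs_of_nonpos] <;> linarith
    have h2 := Real.one_le_rpow hM hp
    rw [zero_sub, abs_neg, abs_one]
    exact one_le_mul_of_one_le_of_one_le
      (one_le_mul_of_one_le_of_one_le (by linarith) h2) h1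

/-- The function `min(x², 1) + e^{qx/(q-1)} 1_{x ≥ 1}` dominating all the integrands below. -/
noncomputable def levyDom (q x : ℝ) : ℝ :=
  min (x ^ 2) 1 + (Ici (1 : ℝ)).indicator (fun x => Real.exp (q * x / (q - 1))) x

theorem integrable_levyDom {q : ℝ} {ν : Measure ℝ}
    (hν : ∫⁻ x, ENNReal.ofReal (min (x ^ 2) 1) ∂ν < ⊤)
    (hI : ∫⁻ x in Ici (1 : ℝ), ENNReal.ofReal (Real.exp (q * x / (q - 1))) ∂ν < ⊤) :
    Integrable (levyDom q) ν := by
  have h1 : Integrable (fun x : ℝ => min (x ^ 2) 1) ν :=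
    (lintegral_ofReal_ne_top_iff_integrable
      (by fun_prop) (.of_forall fun x => by positivity)).1 hν.ne
  have h2 : IntegrableOn (fun x : ℝ => Real.exp (q * x / (q - 1))) (Ici 1) ν :=
    (lintegral_ofReal_ne_top_iff_integrable
      (by fun_prop) (.of_forall fun x => by positivity)).1 hI.ne
  exact h1.add ((integrable_indicator_iff measurableSet_Ici).2 h2)

theorem levyDom_of_abs_le {x : ℝ} (q : ℝ) (hx : |x| ≤ 1) : x ^ 2 ≤ levyDom q x := by
  unfold levyDom
  rw [min_eq_left (by rwa [sq_le_one_iff_abs_le_one])]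
  have := indicator_nonneg (s := Ici (1 : ℝ))
    (f := fun x => Real.exp (q * x / (q - 1))) (fun _ _ => (Real.exp_pos _).le) x
  linarith

theorem levyDom_of_lt_neg_one {x : ℝ} (q : ℝ) (hx : x < -1) : 1 ≤ levyDom q x := by
  unfold levyDom
  rw [min_eq_right (by nlinarith)]
  have := indicator_nonneg (s := Ici (1 : ℝ))
    (f := fun x => Real.exp (q * x / (q - 1))) (fun _ _ => (Real.exp_pos _).le) x
  linarith

theorem levyDom_of_one_lt {x : ℝ} (q : ℝ) (hx : 1 < x) :
    Real.exp (q * x / (q - 1)) ≤ levyDom q x := by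
  unfold levyDom
  rw [indicator_of_mem (by exact hx.le)]
  have : 0 ≤ min (x ^ 2) 1 := by positivity
  linarith

theorem exp_conjugate_eq {q : ℝ} (hq : 1 < q) (x : ℝ) :
    Real.exp (q * x / (q - 1)) = Real.exp x * Real.exp x ^ (1 / (q - 1)) := by
  rw [← Real.exp_mul, ← Real.exp_add]
  congr 1
  have : q - 1 ≠ 0 := by linarith
  field_simp
  ring

theorem exp_le_exp_conjugate {q x : ℝ} (hq : 1 < q) (hx : 0 ≤ x) :
    Real.exp x ≤ Real.exp (q * x / (q - 1)) := by
  rw [Real.exp_le_exp, le_div_iff₀ (by linarith)]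
  nlinarith

theorem integrable_exp_sub_one_sub_htrunc {q : ℝ} {ν : Measure ℝ} (hq : 1 < q)
    (hν : Integrable (levyDom q) ν) :
    Integrable (fun x => Real.exp x - 1 - htrunc x) ν := by
  refine hν.mono' (((by fun_prop : Measurable fun x : ℝ => Real.exp x - 1).sub
    measurable_htrunc).aestronglyMeasurable) (.of_forall fun x => ?_)
  rw [Real.norm_eq_abs]
  unfold htrunc
  split_ifs with h
  · exact (Real.abs_exp_sub_one_sub_id_le h).trans (levyDom_of_abs_le q h)
  · rw [sub_zero]
    rcases lt_abs.1 (not_le.1 h) with h | h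
    · refine le_trans ?_ ((exp_le_exp_conjugate hq (by linarith)).trans (levyDom_of_one_lt q h))
      rw [abs_le]
      constructor <;> linarith [Real.one_le_exp (by linarith : 0 ≤ x)]
    · refine le_trans ?_ (levyDom_of_lt_neg_one q (by linarith))
      rw [abs_le]
      constructor <;> linarith [Real.exp_pos x, Real.exp_le_one_iff.2 (by linarith : x ≤ 0)]

theorem integrable_exp_sub_one_mul_Yq_sub_one {q : ℝ} {ν : Measure ℝ} (hq : 1 < q)
    (hν : Integrable (levyDom q) ν) (u : ℝ) :
    Integrable (fun x => (Real.exp x - 1) * (Yq q u x - 1)) ν := by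
  have hp : 0 ≤ 1 / (q - 1) := by
    apply div_nonneg <;> linarith
  have hu : 0 ≤ (q - 1) * |u| := mul_nonneg (by linarith) (abs_nonneg u)
  set p := 1 / (q - 1) with hp_def
  set C := 1 + (q - 1) * |u| with hC
  have hC0 : 0 ≤ C := by positivity
  set A := (1 + p) * (C * Real.exp 1) ^ p * ((q - 1) * |u|) with hA
  have hA0 : 0 ≤ A := by positivity
  have hB0 : 0 ≤ C ^ p := by positivity
  refine (hν.const_mul (4 * A + (C ^ p + 1))).mono'
    (((by fun_prop : Measurable fun x : ℝ => Real.exp x - 1).mul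
      ((measurable_Yq q u).sub_const 1)).aestronglyMeasurable) (.of_forall fun x => ?_)
  rw [Real.norm_eq_abs, abs_mul]
  have hsmall : x ≤ 1 → |Yq q u x - 1| ≤ A * |Real.exp x - 1| := fun hx => by
    refine (abs_Yq_sub_one_le (u := u) hq (Real.one_le_exp zero_le_one)
      (Real.exp_le_exp.2 hx)).trans_eq ?_
    rw [hA]
    ring
  rcases le_or_gt |x| 1 with h | h
  · have hd := levyDom_of_abs_le q h
    calc |Real.exp x - 1| * |Yq q u x - 1|
        ≤ |Real.exp x - 1| * (A * |Real.exp x - 1|) := by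
          gcongr
          exact hsmall (abs_le.1 h).2
      _ = A * |Real.exp x - 1| ^ 2 := by ring
      _ ≤ A * (2 * |x|) ^ 2 := by
          gcongr
          exact Real.abs_exp_sub_one_le h
      _ = 4 * A * x ^ 2 := by rw [mul_pow, sq_abs]; ring
      _ ≤ 4 * A * levyDom q x := by gcongr
      _ ≤ _ := by
          have := mul_nonneg (by linarith : 0 ≤ C ^ p + 1) ((sq_nonneg x).trans hd)
          linarith
  rcases lt_abs.1 h with h | h
  · have hd := levyDom_of_one_lt q h
    have h1 : 1 ≤ Real.exp x := Real.one_le_exp (by linarith)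
    have hY := (Yq_le (u := u) hq h1 le_rfl).2
    rw [← hp_def, ← hC, Real.mul_rpow hC0 (Real.exp_pos x).le] at hY
    have hY0 := Yq_nonneg q u x
    have hE : 1 ≤ Real.exp x ^ p := Real.one_le_rpow h1 hp
    have hmul : 0 ≤ C ^ p * Real.exp x ^ p := by positivity
    calc |Real.exp x - 1| * |Yq q u x - 1|
        ≤ Real.exp x * ((C ^ p + 1) * Real.exp x ^ p) := by
          gcongr
          · rw [abs_le]
            constructor <;> linarith
          · rw [abs_le]
            constructor <;> linarith
      _ = (C ^ p + 1) * Real.exp (q * x / (q - 1)) := by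
          rw [exp_conjugate_eq hq]
          ring
      _ ≤ (C ^ p + 1) * levyDom q x := by gcongr
      _ ≤ _ := by
          have := mul_nonneg hA0 ((Real.exp_pos _).le.trans hd)
          linarith
  · have hd := levyDom_of_lt_neg_one q (by linarith : x < -1)
    have hE : |Real.exp x - 1| ≤ 1 := by
      rw [abs_le]
      constructor <;> linarith [Real.exp_pos x, Real.exp_le_one_iff.2 (by linarith : x ≤ 0)]
    calc |Real.exp x - 1| * |Yq q u x - 1| ≤ 1 * (A * 1) := by
          gcongr
          exact (hsmall (by linarith)).trans (by gcongr)
      _ ≤ 4 * A * levyDom q x := by nlinarith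
      _ ≤ _ := by
          have := mul_nonneg (by linarith : 0 ≤ C ^ p + 1) (zero_le_one.trans hd)
          linarith

theorem integrable_hellinger_Yq {q : ℝ} {ν : Measure ℝ} (hq : 1 < q)
    (hν : Integrable (levyDom q) ν) (u : ℝ) :
    Integrable (fun x => hellinger q (Yq q u x)) ν := by
  have hm := measurable_Yq q u
  refine ((integrable_exp_sub_one_mul_Yq_sub_one hq hν u).const_mul (q * (q - 1) * u)).mono'
    (by unfold hellinger; fun_prop) (.of_forall fun x => ?_)
  rw [Real.norm_eq_abs, abs_of_nonneg (hellinger_nonneg hq (Yq_nonneg q u x))]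
  exact hellinger_Yq_le hq

theorem integrable_exp_sub_one_mul_sub_one {q : ℝ} {ν : Measure ℝ} (hq : 1 < q)
    (hν : Integrable (levyDom q) ν) {Y : ℝ → ℝ} (hY : Measurable Y) (hY0 : ∀ x, 0 ≤ Y x)
    (hH : Integrable (fun x => hellinger q (Y x)) ν) :
    Integrable (fun x => (Real.exp x - 1) * (Y x - 1)) ν := by
  have hK : 0 < q * (q - 1) := mul_pos (by linarith) (by linarith)
  have hG := integrable_exp_sub_one_mul_Yq_sub_one hq hν
  refine (((hH.const_mul (q * (q - 1))⁻¹).add (hG 1).abs).add (hG (-1)).abs).mono'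
    (by fun_prop) (.of_forall fun x => ?_)
  have hbound : ∀ u : ℝ, u * ((Real.exp x - 1) * (Y x - 1)) ≤
      (q * (q - 1))⁻¹ * hellinger q (Y x) + u * ((Real.exp x - 1) * (Yq q u x - 1)) := by
    intro u
    have h1 := hellinger_tangent_le (u := u) (x := x) hq (hY0 x)
    have h2 := hellinger_nonneg hq (Yq_nonneg q u x)
    rw [← sub_le_iff_le_add, inv_mul_eq_div, le_div_iff₀ hK]
    linarith
  have h1 := hbound 1
  have h2 := hbound (-1)
  have h3 := le_abs_self ((Real.exp x - 1) * (Yq q 1 x - 1))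
  have h4 := neg_abs_le ((Real.exp x - 1) * (Yq q (-1) x - 1))
  have h5 := abs_nonneg ((Real.exp x - 1) * (Yq q 1 x - 1))
  have h6 := abs_nonneg ((Real.exp x - 1) * (Yq q (-1) x - 1))
  rw [Real.norm_eq_abs, abs_le]
  simp only [Pi.add_apply]
  constructor <;> linarith

theorem integrable_exp_sub_one_mul_sub_htrunc {q : ℝ} {ν : Measure ℝ} (hq : 1 < q)
    (hν : Integrable (levyDom q) ν) {Y : ℝ → ℝ} (hY : Measurable Y) (hY0 : ∀ x, 0 ≤ Y x)
    (hH : Integrable (fun x => hellinger q (Y x)) ν) :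
    Integrable (fun x => (Real.exp x - 1) * Y x - htrunc x) ν := by
  refine ((integrable_exp_sub_one_mul_sub_one hq hν hY hY0 hH).add
    (integrable_exp_sub_one_sub_htrunc hq hν)).congr (.of_forall fun x => ?_)
  simp only [Pi.add_apply]
  ring

theorem kfun_eq_ofReal {q b c : ℝ} {ν : Measure ℝ} (hq : 1 < q) (hc : 0 < c) {Y : ℝ → ℝ}
    (hY0 : ∀ x, 0 ≤ Y x) (hH : Integrable (fun x => hellinger q (Y x)) ν) :
    kfun q b c ν Y = ENNReal.ofReal (q * (q - 1) / (2 * c) *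
      (b + c / 2 + ∫ x, ((Real.exp x - 1) * Y x - htrunc x) ∂ν) ^ 2 +
        ∫ x, hellinger q (Y x) ∂ν) := by
  have h0 : ∀ x, 0 ≤ hellinger q (Y x) := fun x => hellinger_nonneg hq (hY0 x)
  have hK : 0 ≤ q * (q - 1) := mul_nonneg (by linarith) (by linarith)
  rw [ENNReal.ofReal_add (by positivity) (integral_nonneg h0),
    ofReal_integral_eq_lintegral_ofReal hH (.of_forall h0)]
  rfl

/-- variational characterization in Lemma 9: with `c > 0` and `β`
the unique root of `F`, `Y_β` minimises `k` among nonnegative measurable `Y` with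
`∫ |eˣ-1| Y dν < ∞`, and it is the unique minimiser up to `ν`-a.e. equality. -/
theorem stmt_15 (q b c : ℝ) (hq : 1 < q) (hc : 0 < c) (ν : Measure ℝ)
    (hν0 : ν {0} = 0)
    (hν : ∫⁻ x, ENNReal.ofReal (min (x ^ 2) 1) ∂ν < ⊤)
    (hI : ∫⁻ x in Set.Ici (1 : ℝ),
      ENNReal.ofReal (Real.exp (q * x / (q - 1))) ∂ν < ⊤)
    (β : ℝ) (hβ : Fq q b c ν β = 0) :
    ∀ Y : ℝ → ℝ, Measurable Y → (∀ x, 0 ≤ Y x) →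
      Integrable (fun x => |Real.exp x - 1| * Y x) ν →
      kfun q b c ν (Yq q β) ≤ kfun q b c ν Y ∧
      (kfun q b c ν Y = kfun q b c ν (Yq q β) → Y =ᵐ[ν] Yq q β) := by
  intro Y hY hY0 _
  have hdom := integrable_levyDom hν hI
  have hHβ := integrable_hellinger_Yq hq hdom β
  have hkβ := kfun_eq_ofReal (b := b) hq hc (Yq_nonneg q β) hHβ
  by_cases htop : ∫⁻ x, ENNReal.ofReal (hellinger q (Y x)) ∂ν = ⊤
  · have hk : kfun q b c ν Y = ⊤ := by
      change _ + ∫⁻ x, ENNReal.ofReal (hellinger q (Y x)) ∂ν = ⊤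
      rw [htop, add_top]
    rw [hk]
    exact ⟨le_top, fun h => absurd (h.trans hkβ) ENNReal.top_ne_ofReal⟩
  have hH : Integrable (fun x => hellinger q (Y x)) ν :=
    (lintegral_ofReal_ne_top_iff_integrable (by unfold hellinger; fun_prop)
      (.of_forall fun x => hellinger_nonneg hq (hY0 x))).1 htop
  have hJ := integrable_exp_sub_one_mul_sub_htrunc hq hdom hY hY0 hH
  have hJβ := integrable_exp_sub_one_mul_sub_htrunc hq hdom (measurable_Yq q β)
    (Yq_nonneg q β) hHβ
  rw [hkβ, kfun_eq_ofReal hq hc hY0 hH]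
  set J := ∫ x, ((Real.exp x - 1) * Y x - htrunc x) ∂ν
  set Jβ := ∫ x, ((Real.exp x - 1) * Yq q β x - htrunc x) ∂ν
  have hroot : b + c / 2 + Jβ = -(c * β) := by
    unfold Fq at hβ
    linarith
  let D : ℝ → ℝ := fun x => hellinger q (Y x) - hellinger q (Yq q β x) -
    q * (q - 1) * β * (((Real.exp x - 1) * Y x - htrunc x) -
      ((Real.exp x - 1) * Yq q β x - htrunc x))
  have hD0 : 0 ≤ D := fun x => by
    have := hellinger_tangent_le (u := β) (x := x) hq (hY0 x)
    simp only [D, Pi.zero_apply]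
    linarith
  have hDint : Integrable D ν := (hH.sub hHβ).sub ((hJ.sub hJβ).const_mul _)
  have hD : ∫ x, D x ∂ν = ∫ x, hellinger q (Y x) ∂ν - ∫ x, hellinger q (Yq q β x) ∂ν -
      q * (q - 1) * β * (J - Jβ) := by
    have h := integral_sub (hH.sub hHβ) ((hJ.sub hJβ).const_mul (q * (q - 1) * β))
    rwa [integral_sub' hH hHβ, integral_const_mul, integral_sub' hJ hJβ] at h
  have hDnn : 0 ≤ ∫ x, D x ∂ν := integral_nonneg hD0
  have hK : 0 ≤ q * (q - 1) := mul_nonneg (by linarith) (by linarith)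
  have hkey : (q * (q - 1) / (2 * c) * (b + c / 2 + J) ^ 2 + ∫ x, hellinger q (Y x) ∂ν) -
      (q * (q - 1) / (2 * c) * (b + c / 2 + Jβ) ^ 2 + ∫ x, hellinger q (Yq q β x) ∂ν) =
      q * (q - 1) / (2 * c) * (J - Jβ) ^ 2 + ∫ x, D x ∂ν := by
    have hJ' : b + c / 2 + J = -(c * β) + (J - Jβ) := by linarith
    rw [hD, hroot, hJ']
    field_simp
    ring
  have hsq : 0 ≤ q * (q - 1) / (2 * c) * (J - Jβ) ^ 2 := by positivity
  refine ⟨ENNReal.ofReal_le_ofReal (by linarith), fun heq => ?_⟩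
  have hnn : ∀ Z : ℝ → ℝ, (∀ x, 0 ≤ Z x) → 0 ≤ ∫ x, hellinger q (Z x) ∂ν :=
    fun Z hZ => integral_nonneg fun x => hellinger_nonneg hq (hZ x)
  have hnnY := hnn Y hY0
  have hnnβ := hnn _ (Yq_nonneg q β)
  rw [ENNReal.ofReal_eq_ofReal_iff (by positivity) (by positivity)] at heq
  have hDzero : ∫ x, D x ∂ν = 0 := by linarith
  filter_upwards [(integral_eq_zero_iff_of_nonneg hD0 hDint).1 hDzero] with x hx
  by_contra hne
  have := hellinger_tangent_lt (u := β) (x := x) hq (hY0 x) hne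
  simp only [D, Pi.zero_apply] at hx
  linarith
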